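/- arXiv:1501.06260 — 4 statements merged into one kernel-verified Lean document; each statement's English description precedes it below -/
import Mathlib

section
/- Moran's I statistic equals the Rayleigh quotient of W̃ at v = Hᵀy: for every y ∈ ℝⁿ with ỹ := y − ȳ𝟙 ≠ 0, one has vᵀv = ỹᵀỹ ≠ 0 and I(y) = (vᵀ W̃ v)/(vᵀ v). -/
open Matrix BigOperators

/-- The centered vector `ỹ = y - ȳ 𝟙`, where `ȳ` is the mean of the entries of `y`. -/
noncomputable def ytilde (n : ℕ) (y : Fin n → ℝ) : Fin n → ℝ :=
  y - fun _ => (∑ i, y i) / (n : ℝ)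

/-- Moran's `I` statistic:
`I(y) = n (ỹᵀ W ỹ) / (S (ỹᵀ ỹ))` where `S = ∑_{i,j} w_{ij}`. -/
noncomputable def moranI (n : ℕ) (W : Matrix (Fin n) (Fin n) ℝ) (y : Fin n → ℝ) : ℝ :=
  (n : ℝ) * (ytilde n y ⬝ᵥ (W *ᵥ ytilde n y)) /
    ((∑ i, ∑ j, W i j) * (ytilde n y ⬝ᵥ ytilde n y))

/-- If the columns of `H` are orthonormal and orthogonal to `𝟙`, then `H Hᵀ` is the centering
projection. -/
theorem mulVec_transpose_mulVec_eq_ytilde {n : ℕ} (hn : n ≠ 0)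
    (H : Matrix (Fin n) (Fin (n - 1)) ℝ) (hHcol : Hᵀ * H = 1)
    (hHone : Hᵀ *ᵥ (fun _ => (1 : ℝ)) = 0) (y : Fin n → ℝ) :
    H *ᵥ (Hᵀ *ᵥ y) = ytilde n y := by
  have hn' : (n : ℝ) ≠ 0 := Nat.cast_ne_zero.mpr hn
  have hinv : fromRows Hᵀ (replicateRow Unit fun _ => (n : ℝ)⁻¹) *
      fromCols H (replicateCol Unit fun _ => (1 : ℝ)) = 1 := by
    rw [fromRows_mul_fromCols, hHcol, ← fromBlocks_one]
    congr 1
    · ext i j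
      exact congrFun hHone i
    · ext i j
      have h : ∑ k, H k j = 0 := by simpa [mulVec, dotProduct] using congrFun hHone j
      simp [mul_apply, ← Finset.mul_sum, h]
    · ext i j
      simp [mul_apply, hn']
  have hcard : Fintype.card (Fin (n - 1) ⊕ Unit) = Fintype.card (Fin n) := by
    simp only [Fintype.card_sum, Fintype.card_fin, Fintype.card_unit]
    omega
  rw [mul_eq_one_comm_of_card_eq _ _ _ hcard, fromCols_mul_fromRows] at hinv
  rw [mulVec_mulVec, eq_sub_of_add_eq hinv, sub_mulVec, one_mulVec, ytilde]
  congr 1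
  ext i
  simp [mulVec, dotProduct, mul_apply, ← Finset.mul_sum, div_eq_inv_mul]

/-- Moran's `I` equals the Rayleigh quotient of `W̃` at `v = Hᵀ y`:
for every `y` with `ỹ ≠ 0`, one has `vᵀ v = ỹᵀ ỹ ≠ 0` and
`I(y) = (vᵀ W̃ v) / (vᵀ v)`, where `W̃ = (n w̄)⁻¹ Hᵀ W H` and `n w̄ = S / n`. -/
theorem moran_stmt_2 (n : ℕ) (hn : 2 ≤ n)
    (W : Matrix (Fin n) (Fin n) ℝ)
    (hWsym : W.IsSymm)
    (hWdiag : ∀ i, W i i = 0)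
    (hWnonneg : ∀ i j, i ≠ j → 0 ≤ W i j)
    (hS : 0 < ∑ i, ∑ j, W i j)
    (H : Matrix (Fin n) (Fin (n - 1)) ℝ)
    (hHcol : Hᵀ * H = 1)
    (hHone : Hᵀ *ᵥ (fun _ => (1 : ℝ)) = 0)
    (Wt : Matrix (Fin (n - 1)) (Fin (n - 1)) ℝ)
    (hWt : Wt = ((∑ i, ∑ j, W i j) / (n : ℝ))⁻¹ • (Hᵀ * W * H))
    (y : Fin n → ℝ) (hy : ytilde n y ≠ 0) :
    (Hᵀ *ᵥ y) ⬝ᵥ (Hᵀ *ᵥ y) = ytilde n y ⬝ᵥ ytilde n y ∧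
    ytilde n y ⬝ᵥ ytilde n y ≠ 0 ∧
    moranI n W y = ((Hᵀ *ᵥ y) ⬝ᵥ (Wt *ᵥ (Hᵀ *ᵥ y))) / ((Hᵀ *ᵥ y) ⬝ᵥ (Hᵀ *ᵥ y)) := by
  have hv := mulVec_transpose_mulVec_eq_ytilde (by omega) H hHcol hHone y
  generalize Hᵀ *ᵥ y = v at hv ⊢
  have hform (A : Matrix (Fin n) (Fin n) ℝ) :
      ytilde n y ⬝ᵥ (A *ᵥ ytilde n y) = v ⬝ᵥ ((Hᵀ * A * H) *ᵥ v) := by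
    rw [← hv, ← mulVec_mulVec, ← mulVec_mulVec, dotProduct_mulVec v Hᵀ, vecMul_transpose]
  have hnorm : v ⬝ᵥ v = ytilde n y ⬝ᵥ ytilde n y := by
    simpa [hHcol] using (hform 1).symm
  refine ⟨hnorm, mt dotProduct_self_eq_zero.mp hy, ?_⟩
  rw [moranI, hform, hnorm, hWt, smul_mulVec, dotProduct_smul, smul_eq_mul, inv_div,
    div_mul_eq_mul_div, div_div]
end

section
/- (Theorem 1, range of Moran's I.) For every y ∈ ℝⁿ with ỹ := y − ȳ𝟙 ≠ 0, Moran's I statistic satisfies λ_(1) ≤ I(y) ≤ λ_(n−1), where λ_(1) and λ_(n−1) are the smallest and largest eigenvalues of W̃. -/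
open Matrix BigOperators

/-- A lower bound of the spectrum of a real symmetric matrix bounds its quadratic form below. -/
theorem Matrix.IsHermitian.mul_dotProduct_self_le {m : Type*} [Fintype m] [DecidableEq m]
    {A : Matrix m m ℝ} (hA : A.IsHermitian) {c : ℝ} (hc : c ∈ lowerBounds (spectrum ℝ A))
    (x : m → ℝ) : c * (x ⬝ᵥ x) ≤ x ⬝ᵥ (A *ᵥ x) := by
  have hB : (A - algebraMap ℝ (Matrix m m ℝ) c).IsHermitian :=
    hA.sub (by simp [Matrix.IsHermitian, Matrix.algebraMap_eq_diagonal])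
  have hpos : (A - algebraMap ℝ (Matrix m m ℝ) c).PosSemidef := by
    refine hB.posSemidef_iff_eigenvalues_nonneg.mpr fun i => ?_
    have hi := hB.eigenvalues_mem_spectrum_real i
    rw [← spectrum.sub_singleton_eq] at hi
    obtain ⟨a, ha, b, rfl, hab⟩ := hi
    simpa [← hab] using hc ha
  have h := hpos.dotProduct_mulVec_nonneg x
  simpa [Matrix.sub_mulVec, Algebra.algebraMap_eq_smul_one, Matrix.smul_mulVec] using h

/-- An upper bound of the spectrum of a real symmetric matrix bounds its quadratic form above. -/
theorem Matrix.IsHermitian.le_mul_dotProduct_self {m : Type*} [Fintype m] [DecidableEq m]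
    {A : Matrix m m ℝ} (hA : A.IsHermitian) {c : ℝ} (hc : c ∈ upperBounds (spectrum ℝ A))
    (x : m → ℝ) : x ⬝ᵥ (A *ᵥ x) ≤ c * (x ⬝ᵥ x) := by
  have hneg : -c ∈ lowerBounds (spectrum ℝ (-A)) := by
    intro a ha
    rw [← spectrum.neg_eq, Set.mem_neg] at ha
    linarith [hc ha]
  simpa [Matrix.neg_mulVec] using hA.neg.mul_dotProduct_self_le hneg x

/-- The entries of the centered vector sum to zero. -/
theorem sum_ytilde {n : ℕ} (hn : n ≠ 0) (y : Fin n → ℝ) : ∑ i, ytilde n y i = 0 := by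
  have : (n : ℝ) ≠ 0 := Nat.cast_ne_zero.mpr hn
  simp [ytilde, Finset.sum_sub_distrib, mul_div_cancel₀ _ this]

/-- Orthonormal columns orthogonal to `𝟙` complete it to a basis, so `H Hᵀ` fixes the vectors
orthogonal to `𝟙`. -/
theorem mulVec_transpose_mulVec_of_sum_eq_zero {n : ℕ} (hn : n ≠ 0)
    {H : Matrix (Fin n) (Fin (n - 1)) ℝ} (hHcol : Hᵀ * H = 1)
    (hHone : Hᵀ *ᵥ (fun _ => (1 : ℝ)) = 0) {v : Fin n → ℝ} (hv : ∑ i, v i = 0) :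
    H *ᵥ (Hᵀ *ᵥ v) = v := by
  have hn' : (n : ℝ) ≠ 0 := Nat.cast_ne_zero.mpr hn
  have hsum : ∀ j, ∑ i, H i j = 0 := fun j => by
    simpa [Matrix.mulVec, dotProduct] using congrFun hHone j
  let u : Matrix (Fin n) Unit ℝ := Matrix.of fun _ _ => 1
  let w : Matrix Unit (Fin n) ℝ := Matrix.of fun _ _ => (n : ℝ)⁻¹
  have hleft : fromRows Hᵀ w * fromCols H u = 1 := by
    have h12 : Hᵀ * u = 0 := by
      ext i j
      simp [u, Matrix.mul_apply, hsum]
    have h21 : w * H = 0 := by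
      ext i j
      simp [w, Matrix.mul_apply, ← Finset.mul_sum, hsum]
    have h22 : w * u = 1 := by
      ext i j
      simp [w, u, Matrix.mul_apply, hn']
    rw [fromRows_mul_fromCols, hHcol, h12, h21, h22, fromBlocks_one]
  have hcard : Fintype.card (Fin (n - 1) ⊕ Unit) = Fintype.card (Fin n) := by
    simp only [Fintype.card_sum, Fintype.card_fin, Fintype.card_unit]
    omega
  have hright := (Matrix.mul_eq_one_comm_of_card_eq _ _ ℝ hcard).mp hleft
  rw [fromCols_mul_fromRows] at hright
  have hw : w *ᵥ v = 0 := by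
    ext i
    simp [w, Matrix.mulVec, dotProduct, ← Finset.mul_sum, hv]
  simpa [Matrix.add_mulVec, ← Matrix.mulVec_mulVec, hw] using congrArg (· *ᵥ v) hright

/-- Theorem 1, range of Moran's `I`: for every `y` with `ỹ ≠ 0`,
`λ₍₁₎ ≤ I(y) ≤ λ₍ₙ₋₁₎`, where `λ₍₁₎` and `λ₍ₙ₋₁₎` are the smallest and largest
eigenvalues of `W̃ = (n w̄)⁻¹ Hᵀ W H`. -/
theorem moran_stmt_3 (n : ℕ) (hn : 2 ≤ n)
    (W : Matrix (Fin n) (Fin n) ℝ)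
    (hWsym : W.IsSymm)
    (hWdiag : ∀ i, W i i = 0)
    (hWnonneg : ∀ i j, i ≠ j → 0 ≤ W i j)
    (hS : 0 < ∑ i, ∑ j, W i j)
    (H : Matrix (Fin n) (Fin (n - 1)) ℝ)
    (hHcol : Hᵀ * H = 1)
    (hHone : Hᵀ *ᵥ (fun _ => (1 : ℝ)) = 0)
    (Wt : Matrix (Fin (n - 1)) (Fin (n - 1)) ℝ)
    (hWt : Wt = ((∑ i, ∑ j, W i j) / (n : ℝ))⁻¹ • (Hᵀ * W * H))
    (lam1 lamMax : ℝ)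
    (hlam1 : IsLeast (spectrum ℝ Wt) lam1)
    (hlamMax : IsGreatest (spectrum ℝ Wt) lamMax)
    (y : Fin n → ℝ) (hy : ytilde n y ≠ 0) :
    lam1 ≤ moranI n W y ∧ moranI n W y ≤ lamMax := by
  have hn0 : n ≠ 0 := by omega
  have hfix := mulVec_transpose_mulVec_of_sum_eq_zero hn0 hHcol hHone (sum_ytilde hn0 y)
  set v := ytilde n y with hv
  set z := Hᵀ *ᵥ v with hz
  have hquad : ∀ x, z ⬝ᵥ (Hᵀ *ᵥ x) = v ⬝ᵥ x := fun x => by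
    rw [dotProduct_mulVec, vecMul_transpose, hfix]
  have hzz : z ⬝ᵥ z = v ⬝ᵥ v := hquad v
  have hvv : 0 < v ⬝ᵥ v :=
    (Finset.sum_nonneg fun i _ => mul_self_nonneg (v i)).lt_of_ne'
      fun h => hy (dotProduct_self_eq_zero.mp h)
  have hI : moranI n W y = z ⬝ᵥ (Wt *ᵥ z) / (z ⬝ᵥ z) := by
    rw [hWt, Matrix.smul_mulVec, dotProduct_smul, ← Matrix.mulVec_mulVec, hfix,
      ← Matrix.mulVec_mulVec, hquad, hzz, moranI, ← hv, smul_eq_mul, inv_div,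
      div_mul_eq_mul_div, div_div]
  have hWtH : Wt.IsHermitian := by
    change Wtᵀ = Wt
    rw [hWt, transpose_smul, transpose_mul, transpose_mul, transpose_transpose, hWsym.eq,
      Matrix.mul_assoc]
  rw [hI, le_div_iff₀ (hzz ▸ hvv), div_le_iff₀ (hzz ▸ hvv)]
  exact ⟨hWtH.mul_dotProduct_self_le hlam1.2 z, hWtH.le_mul_dotProduct_self hlamMax.2 z⟩
end

section
/- (Theorem 1, attainment of the lower bound.) Let j_(1) ∈ ℝ^{n−1} be a nonzero eigenvector of W̃ for its smallest eigenvalue λ_(1). Then for every c₁ ∈ ℝ and every c₂ ≠ 0, the vector y = c₁𝟙 + c₂ H j_(1) satisfies ỹ ≠ 0 and I(y) = λ_(1). -/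
open Matrix BigOperators

/-- Centering does not move constants plus a vector whose entries sum to zero. -/
theorem ytilde_const_add {n : ℕ} (hn : n ≠ 0) (c : ℝ) {v : Fin n → ℝ} (hv : ∑ i, v i = 0) :
    ytilde n (c • (fun _ => (1 : ℝ)) + v) = v := by
  have hn' : (n : ℝ) ≠ 0 := Nat.cast_ne_zero.mpr hn
  ext i
  simp [ytilde, Finset.sum_add_distrib, hv, hn']

theorem sum_mulVec_eq_zero {m k R : Type*} [Fintype m] [Fintype k] [CommSemiring R]
    {H : Matrix m k R} (hH : Hᵀ *ᵥ (fun _ => (1 : R)) = 0) (x : k → R) :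
    ∑ i, (H *ᵥ x) i = 0 := by
  have h : (fun _ => (1 : R)) ⬝ᵥ (H *ᵥ x) = 0 := by
    rw [dotProduct_mulVec, ← mulVec_transpose, hH, zero_dotProduct]
  simpa [dotProduct] using h

theorem mulVec_dotProduct_mulVec {m k R : Type*} [Fintype m] [Fintype k] [CommSemiring R]
    (H : Matrix m k R) (W : Matrix m m R) (x : k → R) :
    (H *ᵥ x) ⬝ᵥ (W *ᵥ (H *ᵥ x)) = x ⬝ᵥ ((Hᵀ * W * H) *ᵥ x) := by
  rw [← mulVec_mulVec, ← mulVec_mulVec, dotProduct_mulVec x, vecMul_transpose]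

/-- Theorem 1, attainment of the lower bound: if `j₁ ≠ 0` is an
eigenvector of `W̃` for its smallest eigenvalue `λ₍₁₎`, then for every `c₁` and
every `c₂ ≠ 0`, the vector `y = c₁ 𝟙 + c₂ H j₁` satisfies `ỹ ≠ 0` and
`I(y) = λ₍₁₎`. -/
theorem moran_stmt_4 (n : ℕ) (hn : 2 ≤ n)
    (W : Matrix (Fin n) (Fin n) ℝ)
    (hWsym : W.IsSymm)
    (hWdiag : ∀ i, W i i = 0)
    (hWnonneg : ∀ i j, i ≠ j → 0 ≤ W i j)
    (hS : 0 < ∑ i, ∑ j, W i j)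
    (H : Matrix (Fin n) (Fin (n - 1)) ℝ)
    (hHcol : Hᵀ * H = 1)
    (hHone : Hᵀ *ᵥ (fun _ => (1 : ℝ)) = 0)
    (Wt : Matrix (Fin (n - 1)) (Fin (n - 1)) ℝ)
    (hWt : Wt = ((∑ i, ∑ j, W i j) / (n : ℝ))⁻¹ • (Hᵀ * W * H))
    (lam1 : ℝ)
    (hlam1 : IsLeast (spectrum ℝ Wt) lam1)
    (j1 : Fin (n - 1) → ℝ) (hj1 : j1 ≠ 0) (hj1eig : Wt *ᵥ j1 = lam1 • j1)
    (c₁ c₂ : ℝ) (hc₂ : c₂ ≠ 0) :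
    ytilde n (c₁ • (fun _ => (1 : ℝ)) + c₂ • (H *ᵥ j1)) ≠ 0 ∧
    moranI n W (c₁ • (fun _ => (1 : ℝ)) + c₂ • (H *ᵥ j1)) = lam1 := by
  have hn0 : n ≠ 0 := by omega
  have hnR : (n : ℝ) ≠ 0 := Nat.cast_ne_zero.mpr hn0
  have hsum : ∑ i, (c₂ • (H *ᵥ j1)) i = 0 := by
    rw [← mulVec_smul]
    exact sum_mulVec_eq_zero hHone _
  have hpos : j1 ⬝ᵥ j1 ≠ 0 := fun h => hj1 (dotProduct_self_eq_zero.mp h)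
  have hnorm : (H *ᵥ j1) ⬝ᵥ (H *ᵥ j1) = j1 ⬝ᵥ j1 := by
    have h := mulVec_dotProduct_mulVec H 1 j1
    rwa [one_mulVec, Matrix.mul_one, hHcol, one_mulVec] at h
  have hquad : (H *ᵥ j1) ⬝ᵥ (W *ᵥ (H *ᵥ j1)) =
      (∑ i, ∑ j, W i j) / n * (lam1 * (j1 ⬝ᵥ j1)) := by
    have hW : Hᵀ * W * H = ((∑ i, ∑ j, W i j) / (n : ℝ)) • Wt := by
      rw [hWt, smul_inv_smul₀ (div_ne_zero hS.ne' hnR)]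
    rw [mulVec_dotProduct_mulVec, hW, smul_mulVec, hj1eig, dotProduct_smul, dotProduct_smul,
      smul_eq_mul, smul_eq_mul]
  refine ⟨?_, ?_⟩
  · rw [ytilde_const_add hn0 c₁ hsum]
    refine smul_ne_zero hc₂ fun h => hpos ?_
    rw [← hnorm, h, zero_dotProduct]
  · have hS0 := hS.ne'
    rw [moranI, ytilde_const_add hn0 c₁ hsum]
    simp only [mulVec_smul, dotProduct_smul, smul_dotProduct, smul_eq_mul, hquad, hnorm]
    field_simp
end

section
/- The trace of W̃ equals −1, i.e. tr((n w̄)⁻¹ HᵀWH) = −1. -/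
open Matrix BigOperators

/-- If the columns of `H` form an orthonormal basis of the orthogonal complement of the all-ones
vector, then `H * Hᵀ` is the centering matrix. -/
theorem mul_transpose_eq_centering {n : ℕ} (hn : n ≠ 0)
    (H : Matrix (Fin n) (Fin (n - 1)) ℝ) (hHcol : Hᵀ * H = 1)
    (hHone : Hᵀ *ᵥ (fun _ => (1 : ℝ)) = 0) :
    H * Hᵀ = 1 - Matrix.of fun _ _ => (n : ℝ)⁻¹ := by
  have hn' : (n : ℝ) ≠ 0 := Nat.cast_ne_zero.mpr hn
  have hone (j : Fin (n - 1)) : ∑ i, H i j = 0 := by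
    simpa [mulVec, dotProduct] using congrFun hHone j
  let A : Matrix (Fin (n - 1) ⊕ Unit) (Fin n) ℝ := fromRows Hᵀ (of fun _ _ => (n : ℝ)⁻¹)
  let B : Matrix (Fin n) (Fin (n - 1) ⊕ Unit) ℝ := fromCols H (of fun _ _ => 1)
  have hAB : A * B = 1 := by
    rw [fromRows_mul_fromCols, hHcol, ← fromBlocks_one]
    congr 1 <;> ext i j <;> simp [mul_apply, ← Finset.mul_sum, hone, hn']
  have hBA : B * A = 1 :=
    (mul_eq_one_comm_of_card_eq _ _ _ (by simp; lia)).mp hAB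
  rw [fromCols_mul_fromRows] at hBA
  rw [← hBA, eq_sub_iff_add_eq]
  congr 1
  ext i j
  simp [mul_apply]

/-- the trace of `W̃ = (n w̄)⁻¹ Hᵀ W H` equals `-1`
(with `n w̄ = S / n`, `S = ∑_{i,j} w_{ij}`). -/
theorem moran_stmt_9 (n : ℕ) (hn : 2 ≤ n)
    (W : Matrix (Fin n) (Fin n) ℝ)
    (hWsym : W.IsSymm)
    (hWdiag : ∀ i, W i i = 0)
    (hS : 0 < ∑ i, ∑ j, W i j)
    (H : Matrix (Fin n) (Fin (n - 1)) ℝ)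
    (hHcol : Hᵀ * H = 1)
    (hHone : Hᵀ *ᵥ (fun _ => (1 : ℝ)) = 0)
    (Wt : Matrix (Fin (n - 1)) (Fin (n - 1)) ℝ)
    (hWt : Wt = ((∑ i, ∑ j, W i j) / (n : ℝ))⁻¹ • (Hᵀ * W * H)) :
    Matrix.trace Wt = -1 := by
  have htrace : trace (Hᵀ * W * H) = -((∑ i, ∑ j, W i j) / (n : ℝ)) := by
    rw [trace_mul_comm, ← Matrix.mul_assoc,
      mul_transpose_eq_centering (by lia) H hHcol hHone, trace_mul_comm, Matrix.mul_sub, trace_sub]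
    simp [trace, mul_apply, hWdiag, ← Finset.sum_mul, div_eq_mul_inv]
  have hn' : (0 : ℝ) < n := by exact_mod_cast (by lia : 0 < n)
  rw [hWt, trace_smul, htrace, smul_eq_mul, mul_neg, inv_mul_cancel₀ (div_pos hS hn').ne']
end
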